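/- A cardinal κ is weakly inaccessible if and only if it is weakly (Σ₁,Cd,κ⁺)-shrewd, where Cd is the class of all infinite cardinals. Similarly, κ is weakly Mahlo if and only if it is weakly (Σ₁,Rg,κ⁺)-shrewd, where Rg is the class of all regular cardinals. -/

import Mathlib

universe u

open Cardinal

/-- Formulas of the language of set theory with an additional unary predicate
symbol `pred`; variables are indexed by natural numbers. -/
inductive SF : Type
  | mem : ℕ → ℕ → SF
  | eq : ℕ → ℕ → SF
  | pred : ℕ → SF
  | not : SF → SF
  | and : SF → SF → SF
  | ex : ℕ → SF → SF

/-- The free variables of a formula. -/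
def SF.fv : SF → Set ℕ
  | .mem i j => {i, j}
  | .eq i j => {i, j}
  | .pred i => {i}
  | .not φ => φ.fv
  | .and φ ψ => φ.fv ∪ ψ.fv
  | .ex k φ => φ.fv \ {k}

/-- Tarskian satisfaction of a formula in the structure whose carrier is the
class `S`, where the membership symbol is interpreted by the binary relation `E`
and the extra unary predicate symbol by the class `P`, under the valuation `v`. -/
def Sat (P : Set ZFSet.{u}) (E : ZFSet.{u} → ZFSet.{u} → Prop) (S : Set ZFSet.{u}) :
    SF → (ℕ → ZFSet.{u}) → Prop
  | .mem i j, v => E (v i) (v j)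
  | .eq i j, v => v i = v j
  | .pred i, v => v i ∈ P
  | .not φ, v => ¬ Sat P E S φ v
  | .and φ ψ, v => Sat P E S φ v ∧ Sat P E S ψ v
  | .ex k φ, v => ∃ x, x ∈ S ∧ Sat P E S φ (Function.update v k x)

/-- Satisfaction in the `∈`-structure with carrier `S`, the predicate symbol
being interpreted by the class `R`. -/
def SatIn (R : Set ZFSet.{u}) (S : Set ZFSet.{u}) (φ : SF) (v : ℕ → ZFSet.{u}) : Prop :=
  Sat R (· ∈ ·) S φ v

/-- Δ₀-formulas: built from atomic formulas by propositional connectives and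
bounded existential quantification. -/
inductive IsDeltaZero : SF → Prop
  | mem (i j) : IsDeltaZero (.mem i j)
  | eq (i j) : IsDeltaZero (.eq i j)
  | pred (i) : IsDeltaZero (.pred i)
  | not {φ} : IsDeltaZero φ → IsDeltaZero (.not φ)
  | and {φ ψ} : IsDeltaZero φ → IsDeltaZero ψ → IsDeltaZero (.and φ ψ)
  | bex {φ} (k j) : IsDeltaZero φ → IsDeltaZero (.ex k (.and (.mem k j) φ))

mutual
  /-- Σₙ-formulas of the Lévy hierarchy. -/
  inductive IsSigma : ℕ → SF → Prop
    | of_zero {φ} : IsDeltaZero φ → IsSigma 0 φ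
    | of_pi {n φ} : IsPi n φ → IsSigma (n + 1) φ
    | ex {n φ} (k) : IsSigma (n + 1) φ → IsSigma (n + 1) (.ex k φ)
  /-- Πₙ-formulas of the Lévy hierarchy. -/
  inductive IsPi : ℕ → SF → Prop
    | of_zero {φ} : IsDeltaZero φ → IsPi 0 φ
    | not {n φ} : IsSigma (n + 1) φ → IsPi (n + 1) (.not φ)
end

/-- The valuation sending `v₀` to `a`, `v₁` to `b` and all other variables to `∅`. -/
def val2 (a b : ZFSet.{u}) : ℕ → ZFSet.{u} := fun i => if i = 0 then a else if i = 1 then b else ∅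

/-- `x` is a (von Neumann) ordinal. -/
def ZOrd (x : ZFSet.{u}) : Prop := x.IsTransitive ∧ ∀ y ∈ x, ZFSet.IsTransitive y

/-- `κ` is a (von Neumann) cardinal. -/
def ZCard (κ : ZFSet.{u}) : Prop := ZOrd κ ∧ ∀ β ∈ κ, #β.toSet < #κ.toSet

/-- `κ` is an infinite cardinal. -/
def InfCard (κ : ZFSet.{u}) : Prop := ZCard κ ∧ ZFSet.omega ⊆ κ

/-- `κ` is an infinite regular cardinal: every cofinal subset of `κ` has
cardinality `κ`. -/
def ZRegular (κ : ZFSet.{u}) : Prop :=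
  InfCard κ ∧ ∀ x : ZFSet.{u}, x ⊆ κ →
    (∀ β ∈ κ, ∃ γ ∈ x, β ∈ γ ∨ β = γ) → #x.toSet = #κ.toSet

/-- `C` is a closed unbounded (class of) subset(s) of the ordinal `κ`. -/
def ZClub (C : Set ZFSet.{u}) (κ : ZFSet.{u}) : Prop :=
  (∀ γ ∈ C, γ ∈ κ) ∧ (∀ β ∈ κ, ∃ γ ∈ C, β ∈ γ) ∧
    (∀ β ∈ κ, (∃ γ, γ ∈ β) → (∀ γ ∈ β, ∃ δ ∈ C, γ ∈ δ ∧ δ ∈ β) → β ∈ C)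

/-- `S` is stationary in `κ`: it meets every closed unbounded subset of `κ`. -/
def ZStationary (S : Set ZFSet.{u}) (κ : ZFSet.{u}) : Prop :=
  ∀ C, ZClub C κ → ∃ γ ∈ C, γ ∈ S

/-- `H(θ)`: the class of all sets hereditarily of cardinality less than `θ`. -/
def HSet (θ : ZFSet.{u}) : Set ZFSet.{u} :=
  {x | ∃ t : ZFSet.{u}, t.IsTransitive ∧ x ⊆ t ∧ #t.toSet < #θ.toSet}

/-- `θ` is the cardinal successor `κ⁺` of `κ`. -/
def SuccCardOf (θ κ : ZFSet.{u}) : Prop :=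
  ZCard θ ∧ κ ∈ θ ∧ ∀ μ, ZCard μ → κ ∈ μ → θ ⊆ μ

/-- `κ` is a weakly shrewd cardinal. -/
def WeaklyShrewd (κ : ZFSet.{u}) : Prop :=
  InfCard κ ∧
    ∀ (φ : SF) (θ A : ZFSet.{u}), φ.fv ⊆ {0, 1} → ZCard θ → κ ∈ θ → A ⊆ κ →
      SatIn ∅ (HSet θ) φ (val2 A κ) →
      ∃ κ' θ' : ZFSet.{u}, ZCard κ' ∧ ZCard θ' ∧ κ' ∈ θ' ∧ κ' ∈ κ ∧
        SatIn ∅ (HSet θ') φ (val2 (A ∩ κ') κ')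

/-- `j` is an elementary embedding of the `∈`-structure (with predicate `R`)
with carrier `X` into the one with carrier `Y`. -/
def ElemEmbOn (R : Set ZFSet.{u}) (X Y : Set ZFSet.{u}) (j : ZFSet.{u} → ZFSet.{u}) : Prop :=
  (∀ x ∈ X, j x ∈ Y) ∧
    ∀ (φ : SF) (v : ℕ → ZFSet.{u}), (∀ i, v i ∈ X) →
      (SatIn R X φ v ↔ SatIn R Y φ (fun i => j (v i)))

/-- `X` is an elementary submodel of `Y` (as `∈`-structures with predicate `R`). -/
def ElemSub (R : Set ZFSet.{u}) (X Y : Set ZFSet.{u}) : Prop :=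
  X ⊆ Y ∧ ∀ (φ : SF) (v : ℕ → ZFSet.{u}), (∀ i, v i ∈ X) → (SatIn R X φ v ↔ SatIn R Y φ v)

/-- `X` is a Σₙ-elementary submodel of `Y`. -/
def SigmaElemSub (R : Set ZFSet.{u}) (n : ℕ) (X Y : Set ZFSet.{u}) : Prop :=
  X ⊆ Y ∧ ∀ (φ : SF), IsSigma n φ → ∀ (v : ℕ → ZFSet.{u}), (∀ i, v i ∈ X) →
    (SatIn R X φ v ↔ SatIn R Y φ v)

/-- `κ` is weakly `(Σₙ, R, θ)`-shrewd: for every Σₙ-formula `Φ(v₀,v₁)` of the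
language of set theory with a unary predicate (interpreted by `R`) and every
`A ⊆ κ` such that `Φ(A,κ)` holds in `⟨H(θ),∈,R⟩`, there are cardinals
`κ̄ < θ̄` with `κ̄ < κ` such that `Φ(A ∩ κ̄, κ̄)` holds in `⟨H(θ̄),∈,R⟩`. -/
def WeaklyShrewdAt (R : Set ZFSet.{u}) (n : ℕ) (θ κ : ZFSet.{u}) : Prop :=
  InfCard κ ∧ κ ∈ θ ∧
    ∀ (φ : SF) (A : ZFSet.{u}), φ.fv ⊆ {0, 1} → IsSigma n φ → A ⊆ κ →
      SatIn R (HSet θ) φ (val2 A κ) →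
      ∃ κ' θ' : ZFSet.{u}, ZCard κ' ∧ ZCard θ' ∧ κ' ∈ θ' ∧ κ' ∈ κ ∧
        SatIn R (HSet θ') φ (val2 (A ∩ κ') κ')

/-- The class of all infinite cardinals. -/
def Cd : Set ZFSet.{u} := {x | InfCard x}

/-- The class of all regular cardinals. -/
def Rg : Set ZFSet.{u} := {x | ZRegular x}

/-- `κ` is weakly inaccessible: an uncountable regular limit cardinal. -/
def WeaklyInacc (κ : ZFSet.{u}) : Prop :=
  ZRegular κ ∧ ZFSet.omega ∈ κ ∧ ∀ β ∈ κ, ∃ μ : ZFSet.{u}, ZCard μ ∧ β ∈ μ ∧ μ ∈ κ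

/-- `κ` is weakly Mahlo: regular with stationarily many regular cardinals below. -/
def WeaklyMahlo (κ : ZFSet.{u}) : Prop :=
  ZRegular κ ∧ ZStationary {β : ZFSet.{u} | ZRegular β} κ

section Logic

variable {R : Set ZFSet.{u}}

theorem sat_congr {P : Set ZFSet.{u}} {E : ZFSet.{u} → ZFSet.{u} → Prop} {S : Set ZFSet.{u}}
    (φ : SF) : ∀ v w : ℕ → ZFSet.{u}, (∀ i ∈ φ.fv, v i = w i) →
      (Sat P E S φ v ↔ Sat P E S φ w) := by
  induction φ with
  | mem i j => intro v w h; simp [Sat, h i (by simp [SF.fv]), h j (by simp [SF.fv])]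
  | eq i j => intro v w h; simp [Sat, h i (by simp [SF.fv]), h j (by simp [SF.fv])]
  | pred i => intro v w h; simp [Sat, h i (by simp [SF.fv])]
  | not φ ih => intro v w h; simp only [Sat]; rw [ih v w h]
  | and φ ψ ih1 ih2 =>
    intro v w h; simp only [Sat]
    rw [ih1 v w (fun i hi => h i (Or.inl hi)), ih2 v w (fun i hi => h i (Or.inr hi))]
  | ex k φ ih =>
    intro v w h; simp only [Sat]
    refine exists_congr fun x => and_congr_right fun _ => ih _ _ fun i hi => ?_
    by_cases hk : i = k
    · subst hk; simp
    · simp only [Function.update_of_ne hk]; exact h i ⟨hi, hk⟩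

/-- A strict bound for all variables of a formula. -/
def SF.bd : SF → ℕ
  | .mem i j => i + j + 1
  | .eq i j => i + j + 1
  | .pred i => i + 1
  | .not φ => φ.bd
  | .and φ ψ => φ.bd + ψ.bd
  | .ex _ φ => φ.bd

theorem SF.fv_lt_bd (φ : SF) : ∀ i ∈ φ.fv, i < φ.bd := by
  induction φ with
  | mem i j => intro a h; simp [SF.fv] at h; simp [SF.bd]; omega
  | eq i j => intro a h; simp [SF.fv] at h; simp [SF.bd]; omega
  | pred i => intro a h; simp [SF.fv] at h; simp [SF.bd]; omega
  | not φ ih => exact ih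
  | and φ ψ ih1 ih2 =>
    intro a h
    simp only [SF.bd]
    rcases h with h | h
    · have := ih1 a h; omega
    · have := ih2 a h; omega
  | ex k φ ih => intro a h; exact ih a h.1

/-- The valuation given by a list. -/
def lv (l : List ZFSet.{u}) : ℕ → ZFSet.{u} := fun i => l.getD i ∅

/-- Tarski–Vaught. -/
theorem tarski_vaught {X T : Set ZFSet.{u}} (hX : X ⊆ T)
    (h : ∀ (φ : SF) (k : ℕ) (l : List ZFSet.{u}), (∀ x ∈ l, x ∈ X) →
      (∃ x ∈ T, Sat R (· ∈ ·) T φ (Function.update (lv l) k x)) →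
      ∃ x ∈ X, Sat R (· ∈ ·) T φ (Function.update (lv l) k x)) (φ : SF) :
    ∀ v : ℕ → ZFSet.{u}, (∀ i, v i ∈ X) →
      (Sat R (· ∈ ·) X φ v ↔ Sat R (· ∈ ·) T φ v) := by
  induction φ with
  | mem i j => intro v hv; rfl
  | eq i j => intro v hv; rfl
  | pred i => intro v hv; rfl
  | not φ ih => intro v hv; simp only [Sat]; rw [ih v hv]
  | and φ ψ ih1 ih2 => intro v hv; simp only [Sat]; rw [ih1 v hv, ih2 v hv]
  | ex k φ ih =>
    intro v hv
    have hup : ∀ x ∈ X, ∀ i, Function.update v k x i ∈ X := by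
      intro x hx i
      by_cases hk : i = k
      · subst hk; simpa using hx
      · simpa [Function.update_of_ne hk] using hv i
    have hc : ∀ x, Sat R (· ∈ ·) T φ (Function.update v k x) ↔
        Sat R (· ∈ ·) T φ (Function.update (lv (List.ofFn fun i : Fin φ.bd => v i)) k x) := by
      intro x
      refine sat_congr φ _ _ fun i hi => ?_
      by_cases hk : i = k
      · subst hk; simp
      · have := φ.fv_lt_bd i hi
        simp [Function.update_of_ne hk, lv, List.getD, this]
    simp only [Sat]
    constructor
    · rintro ⟨x, hx, hs⟩
      exact ⟨x, hX hx, (ih _ (hup x hx)).1 hs⟩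
    · rintro ⟨x, hx, hs⟩
      obtain ⟨y, hy, hs'⟩ := h φ k (List.ofFn fun i : Fin φ.bd => v i)
        (by intro x hx; obtain ⟨i, rfl⟩ := (List.mem_ofFn' _ _).1 hx; exact hv _)
        ⟨x, hx, (hc x).1 hs⟩
      exact ⟨y, hy, (ih _ (hup y hy)).2 ((hc y).2 hs')⟩

/-- Transitive classes. -/
def TransC (S : Set ZFSet.{u}) : Prop := ∀ x ∈ S, ∀ y ∈ x, y ∈ S

theorem upd_mem {S : Set ZFSet.{u}} {v : ℕ → ZFSet.{u}} (hv : ∀ i, v i ∈ S) {x} (hx : x ∈ S) (k : ℕ) :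
    ∀ i, Function.update v k x i ∈ S := by
  intro i
  by_cases hk : i = k
  · subst hk; simpa using hx
  · simpa [Function.update_of_ne hk] using hv i

theorem delta_abs {S : Set ZFSet.{u}} (hS : TransC S) {φ : SF} (hφ : IsDeltaZero φ) :
    ∀ v : ℕ → ZFSet.{u}, (∀ i, v i ∈ S) →
      (Sat R (· ∈ ·) S φ v ↔ Sat R (· ∈ ·) Set.univ φ v) := by
  induction hφ with
  | mem i j => intro v hv; rfl
  | eq i j => intro v hv; rfl
  | pred i => intro v hv; rfl
  | not _ ih => intro v hv; simp only [Sat]; rw [ih v hv]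
  | and _ _ ih1 ih2 => intro v hv; simp only [Sat]; rw [ih1 v hv, ih2 v hv]
  | bex k j _ ih =>
    intro v hv
    simp only [Sat, Set.mem_univ, true_and]
    refine exists_congr fun x => ?_
    constructor
    · rintro ⟨hx, h1, h2⟩
      exact ⟨h1, (ih _ (upd_mem hv hx k)).1 h2⟩
    · rintro ⟨h1, h2⟩
      have hx : x ∈ S := by
        by_cases hk : j = k
        · subst hk; simp at h1; exact absurd h1 (ZFSet.mem_irrefl _)
        · simp [Function.update_of_ne hk] at h1; exact hS _ (hv j) _ h1
      exact ⟨hx, h1, (ih _ (upd_mem hv hx k)).2 h2⟩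

theorem sigma_one_cases {φ : SF} (h : IsSigma 1 φ) :
    IsDeltaZero φ ∨ ∃ k ψ, φ = .ex k ψ ∧ IsSigma 1 ψ := by
  cases h with
  | of_pi h => cases h with
    | of_zero h => exact Or.inl h
  | ex k h => exact Or.inr ⟨k, _, rfl, h⟩

theorem sigma_up {S S' : Set ZFSet.{u}} (hS : TransC S) (hS' : TransC S') (hsub : S ⊆ S')
    (φ : SF) : IsSigma 1 φ → ∀ v : ℕ → ZFSet.{u}, (∀ i, v i ∈ S) →
      Sat R (· ∈ ·) S φ v → Sat R (· ∈ ·) S' φ v := by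
  have hd : ∀ φ, IsDeltaZero φ → ∀ v : ℕ → ZFSet.{u}, (∀ i, v i ∈ S) →
      Sat R (· ∈ ·) S φ v → Sat R (· ∈ ·) S' φ v := fun φ h v hv hs =>
    (delta_abs hS' h v (fun i => hsub (hv i))).2 ((delta_abs hS h v hv).1 hs)
  induction φ with
  | ex k ψ ih =>
    intro hφ v hv hs
    rcases sigma_one_cases hφ with h | ⟨k', ψ', he, h⟩
    · exact hd _ h v hv hs
    · cases he
      obtain ⟨x, hx, hs⟩ := hs
      exact ⟨x, hsub hx, ih h _ (upd_mem hv hx k) hs⟩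
  | _ =>
    intro hφ v hv hs
    rcases sigma_one_cases hφ with h | ⟨k', ψ', he, h⟩
    · exact hd _ h v hv hs
    · cases he

theorem HSet_trans (θ : ZFSet.{u}) : TransC (HSet θ) := by
  rintro x ⟨t, ht, hxt, hc⟩ y hy
  exact ⟨t, ht, ht y (hxt hy), hc⟩

theorem HSet_self {θ x : ZFSet.{u}} (hx : x.IsTransitive) (h : #x.toSet < #θ.toSet) {y} (hy : y ⊆ x) :
    y ∈ HSet θ := ⟨x, hx, hy, h⟩

theorem mk_toSet (x : ZFSet.{u}) : #x.toSet = Cardinal.lift.{u+1} x.card :=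
  ZFSet.cardinalMk_coe_sort

theorem mk_lt_iff {x y : ZFSet.{u}} : #x.toSet < #y.toSet ↔ x.card < y.card := by
  rw [mk_toSet, mk_toSet, Cardinal.lift_lt]

theorem mk_eq_iff {x y : ZFSet.{u}} : #x.toSet = #y.toSet ↔ x.card = y.card := by
  rw [mk_toSet, mk_toSet, Cardinal.lift_inj]

theorem sigma_down {θ : ZFSet.{u}} (hθ : ℵ₀ ≤ θ.card) (φ : SF) :
    IsSigma 1 φ → ∀ v : ℕ → ZFSet.{u}, (∀ i, v i ∈ HSet θ) → Sat R (· ∈ ·) (HSet θ) φ v →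
      ∃ t₀ : ZFSet.{u}, t₀.IsTransitive ∧ t₀.card < θ.card ∧ ∀ t : ZFSet.{u}, t.IsTransitive →
        t₀ ⊆ t → (∀ i, v i ∈ t) → Sat R (· ∈ ·) {x | x ∈ t} φ v := by
  have hd : ∀ φ, IsDeltaZero φ → ∀ v : ℕ → ZFSet.{u}, (∀ i, v i ∈ HSet θ) →
      Sat R (· ∈ ·) (HSet θ) φ v →
      ∃ t₀ : ZFSet.{u}, t₀.IsTransitive ∧ t₀.card < θ.card ∧ ∀ t : ZFSet.{u}, t.IsTransitive →
        t₀ ⊆ t → (∀ i, v i ∈ t) → Sat R (· ∈ ·) {x | x ∈ t} φ v := by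
    intro φ h v hv hs
    refine ⟨∅, ZFSet.isTransitive_empty, ?_, fun t ht _ hvt => ?_⟩
    · rw [ZFSet.card_empty]; exact lt_of_lt_of_le Cardinal.aleph0_pos hθ
    · have h1 := (delta_abs (HSet_trans θ) h v hv).1 hs
      exact (delta_abs (S := {x | x ∈ t}) (fun x hx y hy => ht x hx hy) h v hvt).2 h1
  induction φ with
  | ex k ψ ih =>
    intro hφ v hv hs
    rcases sigma_one_cases hφ with h | ⟨k', ψ', he, h⟩
    · exact hd _ h v hv hs
    · cases he
      obtain ⟨x, hx, hs⟩ := hs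
      obtain ⟨t₀, h1, h2, h3⟩ := ih h _ (upd_mem hv hx k) hs
      obtain ⟨t₁, g1, g2, g3⟩ := hx
      rw [mk_lt_iff] at g3
      have htr : (insert x t₁ : ZFSet).IsTransitive := by
        intro y hy z hz
        rw [ZFSet.mem_insert_iff] at hy ⊢
        rcases hy with rfl | hy
        · exact Or.inr (g2 hz)
        · exact Or.inr (g1 y hy hz)
      refine ⟨t₀ ∪ insert x t₁, h1.union htr, ?_, fun t ht hsub hvt => ?_⟩
      · refine lt_of_le_of_lt ZFSet.card_union_le (Cardinal.add_lt_of_lt hθ h2 ?_)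
        refine lt_of_le_of_lt ZFSet.card_insert_le (Cardinal.add_lt_of_lt hθ g3 ?_)
        exact lt_of_lt_of_le Cardinal.one_lt_aleph0 hθ
      · have hxt : x ∈ t := hsub (by simp)
        refine ⟨x, hxt, h3 t ht (fun y hy => hsub (by simp [hy])) ?_⟩
        exact upd_mem (S := {x | x ∈ t}) hvt hxt k
  | _ =>
    intro hφ v hv hs
    rcases sigma_one_cases hφ with h | ⟨k', ψ', he, h⟩
    · exact hd _ h v hv hs
    · cases he

end Logic

section Collapse

/-- The Mostowski collapse of `X`. -/
noncomputable def col (X : ZFSet.{u}) (x : ZFSet.{u}) : ZFSet.{u} :=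
  ZFSet.range (fun y : ↥(x ∩ X) => col X y.1)
termination_by x
decreasing_by exact (ZFSet.mem_inter.1 y.2).1

theorem mem_col {X x z : ZFSet.{u}} : z ∈ col X x ↔ ∃ y, y ∈ x ∧ y ∈ X ∧ col X y = z := by
  rw [col, ZFSet.mem_range]
  constructor
  · rintro ⟨⟨y, hy⟩, h⟩
    exact ⟨y, (ZFSet.mem_inter.1 hy).1, (ZFSet.mem_inter.1 hy).2, h⟩
  · rintro ⟨y, h1, h2, h⟩
    exact ⟨⟨y, ZFSet.mem_inter.2 ⟨h1, h2⟩⟩, h⟩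

theorem col_inj {X : ZFSet.{u}}
    (hext : ∀ x ∈ X, ∀ y ∈ X, (∀ z ∈ X, z ∈ x ↔ z ∈ y) → x = y) (x : ZFSet.{u}) : x ∈ X → ∀ y ∈ X, col X x = col X y → x = y := by
  induction x using ZFSet.inductionOn with
  | h x ih =>
    intro hx y hy h
    refine hext x hx y hy fun z hz => ⟨fun hzx => ?_, fun hzy => ?_⟩
    · have : col X z ∈ col X y := h ▸ mem_col.2 ⟨z, hzx, hz, rfl⟩
      obtain ⟨w, hw, hwX, he⟩ := mem_col.1 this
      rw [ih z hzx hz w hwX he.symm]; exact hw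
    · have : col X z ∈ col X x := h ▸ mem_col.2 ⟨z, hzy, hz, rfl⟩
      obtain ⟨w, hw, hwX, he⟩ := mem_col.1 this
      rw [← ih w hw hwX z hz he]; exact hw

theorem col_mem_iff {X : ZFSet.{u}}
    (hext : ∀ x ∈ X, ∀ y ∈ X, (∀ z ∈ X, z ∈ x ↔ z ∈ y) → x = y) {x y : ZFSet.{u}} (hx : x ∈ X) : col X x ∈ col X y ↔ x ∈ y := by
  constructor
  · intro h
    obtain ⟨w, hw, hwX, he⟩ := mem_col.1 h
    rw [← col_inj hext w hwX x hx he]; exact hw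
  · intro h; exact mem_col.2 ⟨x, h, hx, rfl⟩

theorem sat_col {X : ZFSet.{u}}
    (hext : ∀ x ∈ X, ∀ y ∈ X, (∀ z ∈ X, z ∈ x ↔ z ∈ y) → x = y) {R : Set ZFSet.{u}} (hR : ∀ x ∈ X, x ∈ R ↔ col X x ∈ R) (φ : SF) :
    ∀ v : ℕ → ZFSet.{u}, (∀ i, v i ∈ X) →
    (Sat R (· ∈ ·) {x | x ∈ X} φ v ↔
      Sat R (· ∈ ·) {z | ∃ x ∈ X, col X x = z} φ (fun i => col X (v i))) := by
  induction φ with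
  | mem i j => intro v hv; exact (col_mem_iff hext (hv i)).symm
  | eq i j =>
    intro v hv
    exact ⟨fun h => congrArg (col X) h, fun h => col_inj hext _ (hv i) _ (hv j) h⟩
  | pred i => intro v hv; exact hR _ (hv i)
  | not φ ih => intro v hv; simp only [Sat]; rw [ih v hv]
  | and φ ψ ih1 ih2 => intro v hv; simp only [Sat]; rw [ih1 v hv, ih2 v hv]
  | ex k φ ih =>
    intro v hv
    have hu : ∀ x, (fun i => col X (Function.update v k x i)) =
        Function.update (fun i => col X (v i)) k (col X x) := by
      intro x; funext i
      by_cases hk : i = k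
      · subst hk; simp
      · simp [Function.update_of_ne hk]
    simp only [Sat, Set.mem_ofPred_eq]
    constructor
    · rintro ⟨x, hx, hs⟩
      refine ⟨col X x, ⟨x, hx, rfl⟩, ?_⟩
      rw [← hu]; exact (ih _ (upd_mem (S := {x | x ∈ X}) hv hx k)).1 hs
    · rintro ⟨_, ⟨x, hx, rfl⟩, hs⟩
      refine ⟨x, hx, ?_⟩
      rw [← hu] at hs
      exact (ih _ (upd_mem (S := {x | x ∈ X}) hv hx k)).2 hs

end Collapse
section Ords

open Ordinal

theorem zord_iff {x : ZFSet.{u}} : ZOrd x ↔ x.IsOrdinal :=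
  ZFSet.isOrdinal_iff_forall_mem_isTransitive.symm

theorem zord_exists {x : ZFSet.{u}} (h : ZOrd x) : ∃ o : Ordinal.{u}, x = o.toZFSet :=
  ⟨x.rank, ((zord_iff.1 h).toZFSet_rank_eq).symm⟩

theorem zcard_ord (c : Cardinal.{u}) : ZCard c.ord.toZFSet := by
  refine ⟨zord_iff.2 (ZFSet.isOrdinal_toZFSet _), fun β hβ => ?_⟩
  obtain ⟨a, ha, rfl⟩ := mem_toZFSet_iff.1 hβ
  rw [mk_lt_iff, card_toZFSet, card_toZFSet, card_ord]
  exact Cardinal.lt_ord.1 ha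

theorem zcard_iff {x : ZFSet.{u}} : ZCard x ↔ ∃ c : Cardinal.{u}, x = c.ord.toZFSet := by
  constructor
  · rintro ⟨h1, h2⟩
    obtain ⟨o, rfl⟩ := zord_exists h1
    refine ⟨o.card, ?_⟩
    congr 1
    refine le_antisymm ?_ (ord_card_le o)
    by_contra hlt
    push Not at hlt
    have := h2 _ (toZFSet_mem_toZFSet_iff.2 hlt)
    rw [mk_lt_iff, card_toZFSet, card_toZFSet, card_ord] at this
    exact lt_irrefl _ this
  · rintro ⟨c, rfl⟩; exact zcard_ord c

theorem omega_eq : ZFSet.omega.{u} = (ω : Ordinal.{u}).toZFSet := by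
  have hn : ∀ n : ℕ, ZFSet.mk (PSet.ofNat n) = ((n : Ordinal.{u})).toZFSet := by
    intro n
    induction n with
    | zero => simp; rfl
    | succ n ih =>
      rw [Nat.cast_succ, toZFSet_add_one, ← ih]; rfl
  ext x
  rw [mem_toZFSet_iff]
  constructor
  · induction x using Quotient.inductionOn with
    | h x =>
      rintro ⟨⟨n⟩, h⟩
      refine ⟨n, natCast_lt_omega0 n, ?_⟩
      rw [← hn n]
      exact (ZFSet.sound h).symm
  · rintro ⟨a, ha, rfl⟩
    obtain ⟨n, rfl⟩ := lt_omega0.1 ha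
    rw [← hn n]
    exact ⟨⟨n⟩, PSet.Equiv.rfl⟩

theorem infcard_ord {c : Cardinal.{u}} : InfCard c.ord.toZFSet ↔ ℵ₀ ≤ c := by
  rw [InfCard, omega_eq, toZFSet_subset_toZFSet_iff, omega0_le_ord]
  exact ⟨fun h => h.2, fun h => ⟨zcard_ord c, h⟩⟩

theorem infcard_iff {x : ZFSet.{u}} :
    InfCard x ↔ ∃ c : Cardinal.{u}, ℵ₀ ≤ c ∧ x = c.ord.toZFSet := by
  constructor
  · intro h
    obtain ⟨c, rfl⟩ := zcard_iff.1 h.1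
    exact ⟨c, infcard_ord.1 h, rfl⟩
  · rintro ⟨c, h, rfl⟩; exact infcard_ord.2 h

theorem cof_Iio_ord (c : Cardinal.{u}) :
    Order.cof (Set.Iio c.ord) = Cardinal.lift.{u+1} c.ord.cof := by
  rw [cof_Iio, lift_cof]

theorem zregular_of {c : Cardinal.{u}} (hc : c.IsRegular) : ZRegular c.ord.toZFSet := by
  refine ⟨infcard_ord.2 hc.aleph0_le, fun x hx hcof => ?_⟩
  rw [mk_eq_iff]
  refine le_antisymm (ZFSet.card_mono hx) ?_
  rw [card_toZFSet, card_ord]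
  have hs : IsCofinal {a : Set.Iio c.ord | a.1.toZFSet ∈ x} := by
    rintro ⟨a, ha⟩
    obtain ⟨γ, hγ, h⟩ := hcof a.toZFSet (toZFSet_mem_toZFSet_iff.2 ha)
    obtain ⟨b, hb, rfl⟩ := mem_toZFSet_iff.1 (hx hγ)
    refine ⟨⟨b, hb⟩, hγ, ?_⟩
    rcases h with h | h
    · exact (toZFSet_mem_toZFSet_iff.1 h).le
    · exact (toZFSet_injective h).le
  have h1 := Order.cof_le hs
  rw [cof_Iio_ord, hc.cof_ord] at h1
  have h2 : #{a : Set.Iio c.ord | a.1.toZFSet ∈ x} ≤ #x.toSet := by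
    refine Cardinal.mk_le_of_injective (f := fun a => ⟨a.1.1.toZFSet, a.2⟩) ?_
    intro a b h
    have h : a.1.1.toZFSet = b.1.1.toZFSet := congrArg Subtype.val h
    exact Subtype.ext (Subtype.ext (toZFSet_injective h))
  rw [mk_toSet] at h2
  exact Cardinal.lift_le.1 (h1.trans h2)

theorem regular_of_zregular {c : Cardinal.{u}} (hc : ZRegular c.ord.toZFSet) : c.IsRegular := by
  refine ⟨infcard_ord.1 hc.1, ?_⟩
  obtain ⟨s, hs, hs'⟩ := Order.exists_cof_eq (Set.Iio c.ord)
  rw [cof_Iio_ord] at hs'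
  let x : ZFSet.{u} := ZFSet.sep (fun y => ∃ a : Set.Iio c.ord, a ∈ s ∧ a.1.toZFSet = y) c.ord.toZFSet
  have hx := hc.2 x ZFSet.sep_subset (by
    intro β hβ
    obtain ⟨a, ha, rfl⟩ := mem_toZFSet_iff.1 hβ
    obtain ⟨b, hb, hab⟩ := hs ⟨a, ha⟩
    refine ⟨b.1.toZFSet, ZFSet.mem_sep.2 ⟨toZFSet_mem_toZFSet_iff.2 b.2, b, hb, rfl⟩, ?_⟩
    rcases (show a ≤ b.1 from hab).lt_or_eq with h | h
    · exact Or.inl (toZFSet_mem_toZFSet_iff.2 h)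
    · exact Or.inr (by rw [h]))
  have h2 : #x.toSet ≤ #s := by
    refine Cardinal.mk_le_of_surjective (f := fun a : s => ⟨a.1.1.toZFSet,
      ZFSet.mem_sep.2 ⟨toZFSet_mem_toZFSet_iff.2 a.1.2, a.1, a.2, rfl⟩⟩) ?_
    rintro ⟨y, hy⟩
    obtain ⟨_, a, ha, rfl⟩ := ZFSet.mem_sep.1 hy
    exact ⟨⟨a, ha⟩, rfl⟩
  rw [hx, mk_toSet, card_toZFSet, card_ord, hs'] at h2
  exact Cardinal.lift_le.1 h2

/-- Families of fewer than `c` ordinals below `c.ord` are bounded. -/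
theorem bdd_lt {c : Cardinal.{u}} (hc : c.IsRegular) {ι : Type (u+1)}
    (hι : #ι < Cardinal.lift.{u+1} c) (f : ι → Ordinal.{u}) (hf : ∀ i, f i < c.ord) :
    ∃ σ < c.ord, ∀ i, f i < σ := by
  by_contra hcon
  push Not at hcon
  have hs : IsCofinal (Set.range fun i => (⟨f i, hf i⟩ : Set.Iio c.ord)) := by
    rintro ⟨a, ha⟩
    obtain ⟨i, hi⟩ := hcon a ha
    exact ⟨_, ⟨i, rfl⟩, hi⟩
  have h1 := (Order.cof_le hs).trans Cardinal.mk_range_le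
  rw [cof_Iio_ord, hc.cof_ord] at h1
  exact absurd hι (not_lt.2 h1)

theorem mk_Iio_lt {c : Cardinal.{u}} {a : Ordinal.{u}} (ha : a < c.ord) :
    #(Set.Iio a) < Cardinal.lift.{u+1} c := by
  rw [Cardinal.mk_Iio_ordinal]
  exact Cardinal.lift_lt.2 (Cardinal.lt_ord.1 ha)

theorem succ_lt_ord' {c : Cardinal.{u}} (hc : ℵ₀ ≤ c) {a : Ordinal.{u}} (ha : a < c.ord) :
    a + 1 < c.ord := (Cardinal.isSuccLimit_ord hc).add_one_lt ha

/-- Closure points of a function are unbounded. -/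
theorem closure_unbdd {c : Cardinal.{u}} (hc : c.IsRegular) (hc' : ℵ₀ < c)
    (s : Ordinal.{u} → Ordinal.{u}) (hs : ∀ a < c.ord, s a < c.ord) {a₀ : Ordinal.{u}}
    (ha₀ : a₀ < c.ord) : ∃ b < c.ord, a₀ < b ∧ ∀ a < b, s a < b := by
  have hstep : ∀ a, ∃ σ, a < c.ord → σ < c.ord ∧ a < σ ∧ ∀ g < a, s g < σ := by
    intro a
    by_cases ha : a < c.ord
    · obtain ⟨σ, h1, h2⟩ := bdd_lt hc (mk_Iio_lt ha) (fun g => s g.1)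
        (fun g => hs _ (lt_trans g.2 ha))
      refine ⟨max σ (a + 1), fun _ => ⟨max_lt h1 (succ_lt_ord' hc.aleph0_le ha), ?_, ?_⟩⟩
      · exact lt_of_lt_of_le (Order.lt_add_one_iff.2 le_rfl) (le_max_right _ _)
      · intro g hg; exact lt_of_lt_of_le (h2 ⟨g, hg⟩) (le_max_left _ _)
    · exact ⟨0, fun h => absurd h ha⟩
  choose σ hσ using hstep
  let it : ℕ → Ordinal.{u} := fun n => σ^[n] a₀
  have hit : ∀ n, it n < c.ord := by
    intro n
    induction n with
    | zero => exact ha₀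
    | succ n ih => simp only [it, Function.iterate_succ_apply']; exact (hσ _ ih).1
  have hsucc : ∀ n, it (n+1) = σ (it n) := fun n => Function.iterate_succ_apply' _ _ _
  obtain ⟨τ, h1, h2⟩ := bdd_lt hc (ι := ULift.{u+1} ℕ) (by simpa using hc') (fun n => it n.down)
    (fun n => hit _)
  let b := sInf {τ | ∀ n, it n < τ}
  have hne : {τ | ∀ n, it n < τ}.Nonempty := ⟨τ, fun n => h2 ⟨n⟩⟩
  have hb : ∀ n, it n < b := csInf_mem hne
  refine ⟨b, lt_of_le_of_lt (csInf_le' (fun n => h2 ⟨n⟩)) h1, hb 0, fun a ha => ?_⟩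
  have : ¬ ∀ n, it n < a := fun h =>
    absurd (csInf_le' (show a ∈ {τ | ∀ n, it n < τ} from h)) (not_le.2 ha)
  push Not at this
  obtain ⟨n, hn⟩ := this
  have h3 := (hσ _ (hit (n+1))).2.2 a (lt_of_le_of_lt hn (hsucc n ▸ (hσ _ (hit n)).2.1))
  rw [← hsucc] at h3
  exact h3.trans (hb _)

/-- Closure points of a function form a club. -/
theorem closure_club {c : Cardinal.{u}} (hc : c.IsRegular) (hc' : ℵ₀ < c)
    (s : Ordinal.{u} → Ordinal.{u}) (hs : ∀ a < c.ord, s a < c.ord) :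
    ZClub {x | ∃ b < c.ord, 0 < b ∧ (∀ a < b, s a < b) ∧ x = b.toZFSet} c.ord.toZFSet := by
  refine ⟨?_, ?_, ?_⟩
  · rintro _ ⟨b, hb, _, _, rfl⟩
    exact toZFSet_mem_toZFSet_iff.2 hb
  · intro β hβ
    obtain ⟨a, ha, rfl⟩ := mem_toZFSet_iff.1 hβ
    obtain ⟨b, hb, hab, h⟩ := closure_unbdd hc hc' s hs ha
    exact ⟨_, ⟨b, hb, zero_le.trans_lt hab, h, rfl⟩, toZFSet_mem_toZFSet_iff.2 hab⟩
  · rintro β hβ ⟨γ, hγ⟩ h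
    obtain ⟨b, hb, rfl⟩ := mem_toZFSet_iff.1 hβ
    obtain ⟨g, hg, rfl⟩ := mem_toZFSet_iff.1 hγ
    refine ⟨b, hb, zero_le.trans_lt hg, fun a ha => ?_, rfl⟩
    obtain ⟨δ, ⟨d, _, _, hd, rfl⟩, h1, h2⟩ := h _ (toZFSet_mem_toZFSet_iff.2 ha)
    rw [toZFSet_mem_toZFSet_iff] at h1 h2
    exact (hd a h1).trans h2

/-- In a weakly inaccessible cardinal, infinite cardinals are stationary. -/
theorem cd_stationary {c : Cardinal.{u}} (hc : c.IsRegular) (hc' : ℵ₀ < c)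
    (hl : ∀ d < c, Order.succ d < c) : ZStationary Cd c.ord.toZFSet := by
  rintro C ⟨hC1, hC2, hC3⟩
  have hstep : ∀ a : Ordinal.{u}, ∃ σ : Ordinal.{u}, a < c.ord → σ < c.ord ∧ a < σ ∧
      σ.toZFSet ∈ C := by
    intro a
    by_cases ha : a < c.ord
    · obtain ⟨γ, hγ, h⟩ := hC2 _ (toZFSet_mem_toZFSet_iff.2 ha)
      obtain ⟨g, hg, rfl⟩ := mem_toZFSet_iff.1 (hC1 _ hγ)
      exact ⟨g, fun _ => ⟨hg, toZFSet_mem_toZFSet_iff.1 h, hγ⟩⟩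
    · exact ⟨0, fun h => absurd h ha⟩
  choose σ hσ using hstep
  obtain ⟨b, hb, hωb, hcl⟩ := closure_unbdd hc hc' (fun a => max (σ a) (Order.succ a.card).ord)
    (fun a ha => max_lt (hσ a ha).1 (Cardinal.ord_lt_ord.2 (hl _ (Cardinal.lt_ord.1 ha))))
    (a₀ := ω) (by rw [← Cardinal.ord_aleph0]; exact Cardinal.ord_lt_ord.2 hc')
  refine ⟨b.toZFSet, ?_, ?_⟩
  · refine hC3 _ (toZFSet_mem_toZFSet_iff.2 hb) ⟨_, toZFSet_mem_toZFSet_iff.2 hωb⟩ fun γ hγ => ?_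
    obtain ⟨g, hg, rfl⟩ := mem_toZFSet_iff.1 hγ
    have := hσ g (hg.trans hb)
    exact ⟨_, this.2.2, toZFSet_mem_toZFSet_iff.2 this.2.1,
      toZFSet_mem_toZFSet_iff.2 (lt_of_le_of_lt (le_max_left _ _) (hcl g hg))⟩
  · refine ⟨⟨zord_iff.2 (ZFSet.isOrdinal_toZFSet _), fun γ hγ => ?_⟩, ?_⟩
    · obtain ⟨g, hg, rfl⟩ := mem_toZFSet_iff.1 hγ
      rw [mk_lt_iff, card_toZFSet, card_toZFSet]
      have h1 := (lt_of_le_of_lt (le_max_right _ _) (hcl g hg)).le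
      have h2 := Cardinal.ord_le.1 h1
      exact lt_of_lt_of_le (Order.lt_succ _) h2
    · rw [omega_eq, toZFSet_subset_toZFSet_iff]; exact hωb.le

end Ords
section Forward

open Ordinal

/-- A coding of formulas by natural numbers. -/
def SF.code : SF → ℕ
  | .mem i j => Nat.pair 0 (Nat.pair i j)
  | .eq i j => Nat.pair 1 (Nat.pair i j)
  | .pred i => Nat.pair 2 i
  | .not φ => Nat.pair 3 φ.code
  | .and φ ψ => Nat.pair 4 (Nat.pair φ.code ψ.code)
  | .ex k φ => Nat.pair 5 (Nat.pair k φ.code)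

theorem SF.code_inj : ∀ φ ψ : SF, φ.code = ψ.code → φ = ψ := by
  intro φ
  induction φ with
  | not φ ih => intro ψ h; cases ψ <;> simp [SF.code, Nat.pair_eq_pair] at h ⊢; exact ih _ h
  | and φ φ' ih ih' =>
    intro ψ h; cases ψ <;> simp [SF.code, Nat.pair_eq_pair] at h ⊢; exact ⟨ih _ h.1, ih' _ h.2⟩
  | ex k φ ih =>
    intro ψ h; cases ψ <;> simp [SF.code, Nat.pair_eq_pair] at h ⊢; exact ⟨h.1, ih _ h.2⟩
  | _ => intro ψ h; cases ψ <;> simp [SF.code, Nat.pair_eq_pair] at h ⊢; exact h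

instance : Countable SF := ⟨⟨SF.code, fun a b h => SF.code_inj a b h⟩⟩

theorem card_col_le (X x : ZFSet.{u}) : (col X x).card ≤ X.card := by
  rw [← Cardinal.lift_le.{u+1}, ← mk_toSet, ← mk_toSet]
  have : ∀ z : (col X x).toSet, ∃ y : X.toSet, col X y.1 = z.1 := by
    rintro ⟨z, hz⟩
    obtain ⟨y, _, h2, h3⟩ := mem_col.1 hz
    exact ⟨⟨y, h2⟩, h3⟩
  choose g hg using this
  refine Cardinal.mk_le_of_injective (f := g) fun a b h => Subtype.ext ?_
  rw [← hg a, ← hg b, h]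

/-- Bounding Skolem functions. -/
theorem skolem_bound {R : Set ZFSet.{u}} {c : Cardinal.{u}} (hc : c.IsRegular) (hc' : ℵ₀ < c)
    (t : ZFSet.{u}) (idx : ZFSet.{u} → Ordinal.{u}) (hidx : ∀ x, idx x < c.ord)
    (hinj : ∀ x ∈ t, ∀ y ∈ t, idx x = idx y → x = y) (a : Ordinal.{u}) (ha : a < c.ord) :
    ∃ σ < c.ord, (∀ (φ : SF) (k : ℕ) (l : List ZFSet.{u}), (∀ x ∈ l, x ∈ t ∧ idx x < a) →
      (∃ x ∈ t, Sat R (· ∈ ·) {x | x ∈ t} φ (Function.update (lv l) k x)) →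
      ∃ x ∈ t, idx x < σ ∧ Sat R (· ∈ ·) {x | x ∈ t} φ (Function.update (lv l) k x)) ∧
      (∀ x ∈ t, idx x < a → x.rank < c.ord → x.rank < σ) := by
  classical
  let Y := {x : ZFSet.{u} // x ∈ t ∧ idx x < a}
  have hY : #Y < Cardinal.lift.{u+1} c := by
    refine lt_of_le_of_lt ?_ (mk_Iio_lt ha)
    refine Cardinal.mk_le_of_injective (f := fun x : Y => (⟨idx x.1, x.2.2⟩ : Set.Iio a)) ?_
    intro x y h
    exact Subtype.ext (hinj _ x.2.1 _ y.2.1 (congrArg Subtype.val h))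
  have hcl : ℵ₀ < Cardinal.lift.{u+1} c := by simpa using hc'
  obtain ⟨σ₁, h1, h1'⟩ := bdd_lt hc (ι := (SF × ℕ) × List Y) (by
      rw [Cardinal.mk_prod]
      refine Cardinal.mul_lt_of_lt hcl.le ?_ ?_
      · refine lt_of_le_of_lt ?_ hcl
        rw [Cardinal.lift_le_aleph0]
        exact Cardinal.mk_le_aleph0
      · refine lt_of_le_of_lt ?_ (max_lt hcl hY)
        simpa using Cardinal.mk_list_le_max Y)
    (fun p => if h : ∃ x ∈ t, Sat R (· ∈ ·) {x | x ∈ t} p.1.1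
      (Function.update (lv (p.2.map Subtype.val)) p.1.2 x) then idx h.choose else 0)
    (by
      intro p
      beta_reduce
      split_ifs with h
      · exact hidx _
      · exact hc.ord_pos)
  obtain ⟨σ₂, h2, h2'⟩ := bdd_lt hc hY
    (fun x => if x.1.rank < c.ord then x.1.rank else 0)
    (by
      intro p
      beta_reduce
      split_ifs with h
      · exact h
      · exact hc.ord_pos)
  refine ⟨max σ₁ σ₂, max_lt h1 h2, ?_, ?_⟩
  · intro φ k l hl h
    have hl' : ∃ l' : List Y, l'.map Subtype.val = l := by
      refine ⟨l.attach.map fun x => ⟨x.1, hl x.1 x.2⟩, ?_⟩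
      simp
    obtain ⟨l', rfl⟩ := hl'
    have := h1' ((φ, k), l')
    simp only [dif_pos h] at this
    exact ⟨h.choose, h.choose_spec.1, lt_of_lt_of_le this (le_max_left _ _), h.choose_spec.2⟩
  · intro x hx hxa hr
    have := h2' ⟨x, hx, hxa⟩
    simp only [if_pos hr] at this
    exact lt_of_lt_of_le this (le_max_right _ _)

theorem succ_card_le {c : Cardinal.{u}} {θ : ZFSet.{u}} (hθ : SuccCardOf θ c.ord.toZFSet) :
    c < θ.card ∧ ∀ x : ZFSet.{u}, x.card < θ.card → x.card ≤ c := by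
  obtain ⟨h1, h2, h3⟩ := hθ
  have h4 := mk_lt_iff.1 (h1.2 _ h2)
  rw [card_toZFSet, card_ord] at h4
  refine ⟨h4, fun x hx => ?_⟩
  have := ZFSet.card_mono (h3 (Order.succ c).ord.toZFSet (zcard_ord _)
    (toZFSet_mem_toZFSet_iff.2 (Cardinal.ord_lt_ord.2 (Order.lt_succ c))))
  rw [card_toZFSet, card_ord] at this
  exact Order.lt_succ_iff.1 (hx.trans_le this)

theorem val2_mem {S : Set ZFSet.{u}} {a b : ZFSet.{u}} (ha : a ∈ S) (hb : b ∈ S) (h0 : ∅ ∈ S) :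
    ∀ i, val2 a b i ∈ S := by
  intro i
  unfold val2
  split_ifs <;> assumption

theorem shrewd_of_stationary {R : Set ZFSet.{u}} (hR : ∀ x ∈ R, InfCard x) {c : Cardinal.{u}}
    (hc : c.IsRegular) (hc' : ℵ₀ < c) (hκR : c.ord.toZFSet ∈ R)
    (hst : ZStationary R c.ord.toZFSet) {θ : ZFSet.{u}} (hθ : SuccCardOf θ c.ord.toZFSet) :
    WeaklyShrewdAt R 1 θ c.ord.toZFSet := by
  classical
  refine ⟨infcard_ord.2 hc.aleph0_le, hθ.2.1, fun φ A hfv hφ hA hs => ?_⟩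
  obtain ⟨hcθ, hleθ⟩ := succ_card_le hθ
  have hθinf : ℵ₀ ≤ θ.card := hc.aleph0_le.trans hcθ.le
  set κ := c.ord.toZFSet with hκdef
  have hκord : κ.IsOrdinal := ZFSet.isOrdinal_toZFSet _
  have hκcard : κ.card = c := by rw [hκdef, card_toZFSet, card_ord]
  have hκθ : #κ.toSet < #θ.toSet := by rw [mk_lt_iff, hκcard]; exact hcθ
  obtain ⟨t₀, ht₀, ht₀c, hdown⟩ := sigma_down hθinf φ hφ (val2 A κ)
    (val2_mem (HSet_self hκord.isTransitive hκθ hA)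
      (HSet_self hκord.isTransitive hκθ (fun _ h => h))
      (HSet_self hκord.isTransitive hκθ (ZFSet.empty_subset _))) hs
  -- the transitive set
  obtain ⟨t, ht, ht₀t, hAt, hκt, htc⟩ : ∃ t : ZFSet.{u}, t.IsTransitive ∧ t₀ ⊆ t ∧ A ∈ t ∧ κ ∈ t ∧
      t.card ≤ c := by
    refine ⟨t₀ ∪ insert A (insert κ κ), ht₀.union ?_, ?_, ?_, ?_, ?_⟩
    · intro y hy z hz
      simp only [ZFSet.mem_insert_iff] at hy ⊢
      rcases hy with rfl | rfl | hy
      · exact Or.inr (Or.inr (hA hz))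
      · exact Or.inr (Or.inr hz)
      · exact Or.inr (Or.inr (hκord.isTransitive y hy hz))
    · intro z hz; simp [hz]
    · simp
    · simp
    · refine hleθ _ ?_
      have h1 : (1 : Cardinal.{u}) < θ.card := lt_of_lt_of_le Cardinal.one_lt_aleph0 hθinf
      refine lt_of_le_of_lt ZFSet.card_union_le (Cardinal.add_lt_of_lt hθinf ht₀c ?_)
      refine lt_of_le_of_lt ZFSet.card_insert_le (Cardinal.add_lt_of_lt hθinf ?_ h1)
      refine lt_of_le_of_lt ZFSet.card_insert_le (Cardinal.add_lt_of_lt hθinf ?_ h1)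
      rw [hκcard]; exact hcθ
  have hκsub : κ ⊆ t := ht κ hκt
  have h0κ : ∅ ∈ κ := by
    rw [← toZFSet_zero]; exact toZFSet_mem_toZFSet_iff.2 hc.ord_pos
  have h0t : ∅ ∈ t := hκsub h0κ
  have hst' := hdown t ht ht₀t (val2_mem (S := {x | x ∈ t}) hAt hκt h0t)
  -- the indexing
  obtain ⟨idx, hidx, hinj⟩ : ∃ idx : ZFSet.{u} → Ordinal.{u}, (∀ x, idx x < c.ord) ∧
      ∀ x ∈ t, ∀ y ∈ t, idx x = idx y → x = y := by
    have h1 : #t.toSet ≤ #(Set.Iio c.ord) := by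
      rw [mk_toSet, Cardinal.mk_Iio_ordinal, card_ord]; exact Cardinal.lift_le.2 htc
    obtain ⟨e⟩ := h1
    refine ⟨fun x => if h : x ∈ t then (e ⟨x, h⟩).1 else 0, fun x => ?_, fun x hx y hy h => ?_⟩
    · beta_reduce
      split_ifs with h
      · exact (e ⟨x, h⟩).2
      · exact hc.ord_pos
    · simp only [dif_pos hx, dif_pos hy] at h
      exact congrArg Subtype.val (e.injective (Subtype.ext h))
  have hstep : ∀ a : Ordinal.{u}, ∃ σ : Ordinal.{u}, a < c.ord → σ < c.ord ∧ a < σ ∧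
      idx a.toZFSet < σ ∧ idx κ < σ ∧ idx A < σ ∧
      (∀ (φ : SF) (k : ℕ) (l : List ZFSet.{u}), (∀ x ∈ l, x ∈ t ∧ idx x < a) →
      (∃ x ∈ t, Sat R (· ∈ ·) {x | x ∈ t} φ (Function.update (lv l) k x)) →
      ∃ x ∈ t, idx x < σ ∧ Sat R (· ∈ ·) {x | x ∈ t} φ (Function.update (lv l) k x)) ∧
      (∀ x ∈ t, idx x < a → x.rank < c.ord → x.rank < σ) := by
    intro a
    by_cases ha : a < c.ord
    · obtain ⟨σ, h1, h2, h3⟩ := skolem_bound (R := R) hc hc' t idx hidx hinj a ha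
      let m := max (max a (idx a.toZFSet)) (max (idx κ) (idx A))
      have hm : m < c.ord := max_lt (max_lt ha (hidx _)) (max_lt (hidx _) (hidx _))
      have hlt : m < max σ (m + 1) := lt_of_lt_of_le (Order.lt_add_one_iff.2 le_rfl) (le_max_right _ _)
      refine ⟨max σ (m + 1), fun _ => ⟨max_lt h1 (succ_lt_ord' hc.aleph0_le hm), ?_, ?_, ?_, ?_,
        ?_, ?_⟩⟩
      · exact lt_of_le_of_lt ((le_max_left _ _).trans (le_max_left _ _)) hlt
      · exact lt_of_le_of_lt ((le_max_right _ _).trans (le_max_left _ _)) hlt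
      · exact lt_of_le_of_lt ((le_max_left _ _).trans (le_max_right _ _)) hlt
      · exact lt_of_le_of_lt ((le_max_right _ _).trans (le_max_right _ _)) hlt
      · intro φ k l hl h
        obtain ⟨x, hx, hxs, h⟩ := h2 φ k l hl h
        exact ⟨x, hx, lt_of_lt_of_le hxs (le_max_left _ _), h⟩
      · intro x hx hxa hr
        exact lt_of_lt_of_le (h3 x hx hxa hr) (le_max_left _ _)
    · exact ⟨0, fun h => absurd h ha⟩
  choose σ hσ using hstep
  obtain ⟨_, ⟨β, hβ, hβ0, hβcl, rfl⟩, hβR⟩ :=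
    hst _ (closure_club hc hc' σ (fun a ha => (hσ a ha).1))
  set X : ZFSet.{u} := ZFSet.sep (fun x => idx x < β) t with hXdef
  have hX : ∀ x, x ∈ X ↔ x ∈ t ∧ idx x < β := fun x => ZFSet.mem_sep
  have hcl0 := hσ 0 hc.ord_pos
  have hκX : κ ∈ X := (hX _).2 ⟨hκt, hcl0.2.2.2.1.trans (hβcl 0 hβ0)⟩
  have hAX : A ∈ X := (hX _).2 ⟨hAt, hcl0.2.2.2.2.1.trans (hβcl 0 hβ0)⟩
  have hβX : ∀ x ∈ β.toZFSet, x ∈ X := by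
    intro x hx
    obtain ⟨a, ha, rfl⟩ := mem_toZFSet_iff.1 hx
    have hac := ha.trans hβ
    exact (hX _).2 ⟨hκsub (toZFSet_mem_toZFSet_iff.2 hac), (hσ a hac).2.2.1.trans (hβcl a ha)⟩
  have h0X : ∅ ∈ X := hβX _ (by rw [← toZFSet_zero]; exact toZFSet_mem_toZFSet_iff.2 hβ0)
  have hXβ : ∀ x ∈ X, x ∈ κ → x ∈ β.toZFSet := by
    intro x hx hxκ
    obtain ⟨hxt, hxi⟩ := (hX x).1 hx
    obtain ⟨a, ha, rfl⟩ := mem_toZFSet_iff.1 hxκ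
    have h1 := hσ _ ((hidx a.toZFSet))
    have h2 := hσ _ h1.1
    have h3 := hβcl _ (hβcl _ hxi)
    have h4 := h2.2.2.2.2.2.2 _ hxt h1.2.1 (by rw [rank_toZFSet]; exact ha)
    rw [rank_toZFSet] at h4
    exact toZFSet_mem_toZFSet_iff.2 (h4.trans h3)
  have hβκ : ∀ x ∈ β.toZFSet, x ∈ κ := fun x hx => toZFSet_subset_toZFSet_iff.2 hβ.le hx
  -- Tarski-Vaught
  have htv : ∀ (φ : SF) (k : ℕ) (l : List ZFSet.{u}), (∀ x ∈ l, x ∈ {x | x ∈ X}) →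
      (∃ x ∈ {x | x ∈ t}, Sat R (· ∈ ·) {x | x ∈ t} φ (Function.update (lv l) k x)) →
      ∃ x ∈ {x | x ∈ X}, Sat R (· ∈ ·) {x | x ∈ t} φ (Function.update (lv l) k x) := by
    intro φ k l hl h
    have hb : ∃ a < β, ∀ x ∈ l, x ∈ t ∧ idx x < a := by
      clear h
      induction l with
      | nil => exact ⟨0, hβ0, by simp⟩
      | cons y l ih =>
        obtain ⟨a, ha, h⟩ := ih (fun x hx => hl x (List.mem_cons_of_mem _ hx))
        have hy := (hX y).1 (hl y (by simp))
        have hm : max a (idx y) < β := max_lt ha hy.2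
        have h1 := hσ _ (hm.trans hβ)
        refine ⟨σ (max a (idx y)), hβcl _ hm, fun x hx => ?_⟩
        rcases List.mem_cons.1 hx with rfl | hx
        · exact ⟨hy.1, lt_of_le_of_lt (le_max_right _ _) h1.2.1⟩
        · exact ⟨(h x hx).1, (h x hx).2.trans (lt_of_le_of_lt (le_max_left _ _) h1.2.1)⟩
    obtain ⟨a, ha, hl'⟩ := hb
    obtain ⟨x, hx, hxi, hsx⟩ := (hσ a (ha.trans hβ)).2.2.2.2.2.1 φ k l hl' h
    exact ⟨x, (hX x).2 ⟨hx, hxi.trans (hβcl a ha)⟩, hsx⟩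
  have hXt : {x | x ∈ X} ⊆ {x | x ∈ t} := fun x hx => ((hX x).1 hx).1
  have hXsat : Sat R (· ∈ ·) {x | x ∈ X} φ (val2 A κ) :=
    (tarski_vaught hXt htv φ (val2 A κ) (val2_mem (S := {x | x ∈ X}) hAX hκX h0X)).2 hst'
  have hsubX : ∀ x ∈ X, ∀ y ∈ X, (∀ z ∈ X, z ∈ x → z ∈ y) → x ⊆ y := by
    intro x hx y hy h z hz
    by_contra hzy
    obtain ⟨w, hw, hw'⟩ := htv (.and (.mem 2 0) (.not (.mem 2 1))) 2 [x, y]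
      (by intro w hw; simp at hw; rcases hw with rfl | rfl <;> assumption)
      ⟨z, ht x (hXt hx) hz, by simp [Sat, lv, Function.update, hz, hzy]⟩
    simp [Sat, lv, Function.update] at hw'
    exact hw'.2 (h w hw hw'.1)
  have hext : ∀ x ∈ X, ∀ y ∈ X, (∀ z ∈ X, z ∈ x ↔ z ∈ y) → x = y := by
    intro x hx y hy h
    have h1 := hsubX x hx y hy fun z hz => (h z hz).1
    have h2 := hsubX y hy x hx fun z hz => (h z hz).2
    exact ZFSet.ext fun z => ⟨fun h => h1 h, fun h => h2 h⟩
  have hβord : β.toZFSet.IsOrdinal := ZFSet.isOrdinal_toZFSet _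
  have hcolβ : ∀ x, x ∈ β.toZFSet → col X x = x := by
    intro x
    induction x using ZFSet.inductionOn with
    | h x ih =>
      intro hx
      ext z
      rw [mem_col]
      constructor
      · rintro ⟨y, hy, _, rfl⟩
        rw [ih y hy (hβord.mem_trans hy hx)]; exact hy
      · intro hz
        have := hβord.mem_trans hz hx
        exact ⟨z, hz, hβX _ this, ih z hz this⟩
  have hcolsub : ∀ B, B ⊆ κ → col X B = B ∩ β.toZFSet := by
    intro B hB
    ext z
    rw [mem_col, ZFSet.mem_inter]
    constructor
    · rintro ⟨y, hy, hyX, rfl⟩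
      have := hXβ y hyX (hB hy)
      rw [hcolβ y this]; exact ⟨hy, this⟩
    · rintro ⟨h1, h2⟩
      exact ⟨z, h1, hβX z h2, hcolβ z h2⟩
  have hcolκ : col X κ = β.toZFSet := by
    rw [hcolsub κ (fun _ h => h)]
    ext z; rw [ZFSet.mem_inter]; exact ⟨fun h => h.2, fun h => ⟨hβκ z h, h⟩⟩
  have hcol0 : col X ∅ = ∅ := by
    rw [hcolsub ∅ (ZFSet.empty_subset _)]; ext z; simp
  have hXcard : X.card ≤ β.card := by
    rw [← Cardinal.lift_le.{u+1}, ← mk_toSet, ← Cardinal.mk_Iio_ordinal]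
    refine Cardinal.mk_le_of_injective
      (f := fun x : X.toSet => (⟨idx x.1, ((hX x.1).1 x.2).2⟩ : Set.Iio β)) ?_
    intro x y h
    exact Subtype.ext (hinj _ ((hX x.1).1 x.2).1 _ ((hX y.1).1 y.2).1 (congrArg Subtype.val h))
  obtain ⟨b, hb, hbβ⟩ := infcard_iff.1 (hR _ hβR)
  have hbβ' : β = b.ord := toZFSet_injective hbβ
  have hRcol : ∀ x ∈ X, x ∈ R ↔ col X x ∈ R := by
    intro x hx
    constructor
    · intro hxR
      obtain ⟨e, he, rfl⟩ := infcard_iff.1 (hR _ hxR)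
      have hec : e ≤ c := by
        have := ZFSet.card_mono (ht _ (hXt hx))
        rw [card_toZFSet, card_ord] at this
        exact this.trans htc
      rcases hec.lt_or_eq with h | rfl
      · rw [hcolβ _ (hXβ _ hx (toZFSet_mem_toZFSet_iff.2 (Cardinal.ord_lt_ord.2 h)))]
        exact hxR
      · rw [← hκdef, hcolκ]; exact hβR
    · intro hxR
      obtain ⟨e, he, hxe⟩ := infcard_iff.1 (hR _ hxR)
      have heb : e ≤ b := by
        have := (card_col_le X x).trans hXcard
        rwa [hxe, hbβ', card_toZFSet, card_ord, card_ord] at this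
      rcases heb.lt_or_eq with h | rfl
      · have hm : e.ord.toZFSet ∈ β.toZFSet := by
          rw [hbβ']; exact toZFSet_mem_toZFSet_iff.2 (Cardinal.ord_lt_ord.2 h)
        rw [col_inj hext x hx _ (hβX _ hm) (hxe.trans (hcolβ _ hm).symm), ← hxe]
        exact hxR
      · rw [col_inj hext x hx κ hκX (by rw [hxe, hcolκ, hbβ'])]
        exact hκR
  have hM := (sat_col hext hRcol φ _ (val2_mem (S := {x | x ∈ X}) hAX hκX h0X)).1 hXsat
  have hval : (fun i => col X (val2 A κ i)) = val2 (A ∩ β.toZFSet) β.toZFSet := by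
    funext i
    unfold val2
    split_ifs
    · exact hcolsub A hA
    · exact hcolκ
    · exact hcol0
  have hMtr : TransC {z | ∃ x ∈ X, col X x = z} := by
    rintro _ ⟨x, hx, rfl⟩ y hy
    obtain ⟨w, _, hw, rfl⟩ := mem_col.1 hy
    exact ⟨w, hw, rfl⟩
  have hMH : {z | ∃ x ∈ X, col X x = z} ⊆ HSet κ := by
    have h1 : (col X t).IsTransitive := by
      intro y hy z hz
      obtain ⟨x, _, hx, rfl⟩ := mem_col.1 hy
      obtain ⟨w, _, hw, rfl⟩ := mem_col.1 hz
      exact mem_col.2 ⟨w, hXt hw, hw, rfl⟩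
    rintro _ ⟨x, hx, rfl⟩
    refine ⟨col X t, h1, h1 _ (mem_col.2 ⟨x, hXt hx, hx, rfl⟩), ?_⟩
    rw [mk_lt_iff, hκcard]
    exact ((card_col_le X t).trans hXcard).trans_lt (Cardinal.lt_ord.1 hβ)
  refine ⟨β.toZFSet, κ, (hR _ hβR).1, zcard_ord _, toZFSet_mem_toZFSet_iff.2 hβ,
    toZFSet_mem_toZFSet_iff.2 hβ, ?_⟩
  rw [← hval]
  exact sigma_up hMtr (HSet_trans κ) hMH φ hφ _ (fun i => ⟨_, val2_mem (S := {x | x ∈ X}) hAX hκX h0X i, rfl⟩) hM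

end Forward
section Backward

open Ordinal

/-- Bounded existential quantifier. -/
def SF.bex (k j : ℕ) (φ : SF) : SF := .ex k (.and (.mem k j) φ)

/-- Bounded universal quantifier. -/
def SF.ball (k j : ℕ) (φ : SF) : SF := .not (SF.bex k j (.not φ))

theorem dz_bex {φ : SF} (k j : ℕ) (h : IsDeltaZero φ) : IsDeltaZero (SF.bex k j φ) := .bex k j h

theorem dz_ball {φ : SF} (k j : ℕ) (h : IsDeltaZero φ) : IsDeltaZero (SF.ball k j φ) :=
  .not (.bex k j (.not h))

theorem sat_bex {R : Set ZFSet.{u}} {k j : ℕ} (hkj : j ≠ k) {φ : SF} {v : ℕ → ZFSet.{u}} :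
    Sat R (· ∈ ·) Set.univ (SF.bex k j φ) v ↔
      ∃ x ∈ v j, Sat R (· ∈ ·) Set.univ φ (Function.update v k x) := by
  simp [SF.bex, Sat, Function.update_of_ne hkj]

theorem sat_ball {R : Set ZFSet.{u}} {k j : ℕ} (hkj : j ≠ k) {φ : SF} {v : ℕ → ZFSet.{u}} :
    Sat R (· ∈ ·) Set.univ (SF.ball k j φ) v ↔
      ∀ x ∈ v j, Sat R (· ∈ ·) Set.univ φ (Function.update v k x) := by
  rw [SF.ball, Sat, sat_bex hkj]
  simp [Sat]

theorem val2_HSet {θ κ A : ZFSet.{u}} (hθ : ZCard θ) (hκ : ZCard κ) (h : κ ∈ θ) (hA : A ⊆ κ) :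
    ∀ i, val2 A κ i ∈ HSet θ := by
  have := hθ.2 κ h
  exact val2_mem (HSet_self hκ.1.1 this hA) (HSet_self hκ.1.1 this (fun _ h => h))
    (HSet_self hκ.1.1 this (ZFSet.empty_subset _))

/-- Reflection of Σ₁ statements, in absolute form. -/
theorem shrewd_reflect {R : Set ZFSet.{u}} {θ κ : ZFSet.{u}} (hθ : ZCard θ)
    (h : WeaklyShrewdAt R 1 θ κ) {φ : SF} (hφ : IsDeltaZero φ) (hfv : φ.fv ⊆ {0, 1, 2})
    {A F : ZFSet.{u}} (hA : A ⊆ κ) (hF : F ∈ HSet θ)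
    (hs : Sat R (· ∈ ·) Set.univ φ (Function.update (val2 A κ) 2 F)) :
    ∃ κ' F' : ZFSet.{u}, ZCard κ' ∧ κ' ∈ κ ∧
      Sat R (· ∈ ·) Set.univ φ (Function.update (val2 (A ∩ κ') κ') 2 F') := by
  obtain ⟨h1, h2, h3⟩ := h
  obtain ⟨κ', θ', hκ', hθ', h4, h5, F', hF', h6⟩ := h3 (.ex 2 φ) A (by
      intro i hi
      have := hfv hi.1
      have h2 := hi.2
      simp only [Set.mem_insert_iff, Set.mem_singleton_iff] at this h2 ⊢
      tauto) (.ex 2 (.of_pi (.of_zero hφ))) hA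
    ⟨F, hF, (delta_abs (HSet_trans θ) hφ _ (upd_mem (val2_HSet hθ h1.1 h2 hA) hF 2)).2 hs⟩
  refine ⟨κ', F', hκ', h5, ?_⟩
  exact (delta_abs (HSet_trans θ') hφ _ (upd_mem (val2_HSet hθ' hκ' h4
    (fun x hx => (ZFSet.mem_inter.1 hx).2)) hF' 2)).1 h6

/-- The formula used to prove regularity. -/
def regF : SF :=
  SF.bex 3 0 (.and (SF.ball 4 0 (.not (.mem 4 3))) (.and
    (SF.ball 6 3 (SF.bex 4 0 (.and (.mem 3 4) (SF.bex 5 2 (.and (.mem 6 5) (.mem 4 5))))))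
    (SF.ball 4 0 (SF.ball 5 2 (SF.ball 6 3 (SF.ball 7 2 (SF.ball 8 3
      (.not (.and (.mem 3 4) (.and (.mem 4 5) (.and (.mem 6 5) (.and (.mem 4 7) (.and (.mem 8 7)
        (.not (.eq 6 8)))))))))))))))

theorem regF_dz : IsDeltaZero regF := by
  unfold regF
  repeat' first
    | apply dz_bex | apply dz_ball | apply IsDeltaZero.and | apply IsDeltaZero.mem
    | apply IsDeltaZero.eq | apply IsDeltaZero.not

theorem regF_fv : regF.fv ⊆ {0, 1, 2} := by
  intro i hi
  simp [regF, SF.fv, SF.bex, SF.ball] at hi ⊢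
  omega

theorem regF_sat {R : Set ZFSet.{u}} {A κ F : ZFSet.{u}} :
    Sat R (· ∈ ·) Set.univ regF (Function.update (val2 A κ) 2 F) ↔
    ∃ l ∈ A, (∀ a ∈ A, a ∉ l) ∧ (∀ x ∈ l, ∃ a ∈ A, l ∈ a ∧ ∃ p ∈ F, x ∈ p ∧ a ∈ p) ∧
      (∀ a ∈ A, ∀ p ∈ F, ∀ x ∈ l, ∀ q ∈ F, ∀ y ∈ l,
        l ∈ a → a ∈ p → x ∈ p → a ∈ q → y ∈ q → x = y) := by
  simp [regF, sat_bex, sat_ball, Sat, Function.update, val2]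

/-- The formula `R(κ)` and `A` is nonempty. -/
theorem reflect_pred {R : Set ZFSet.{u}} {θ κ : ZFSet.{u}} (hθ : ZCard θ)
    (h : WeaklyShrewdAt R 1 θ κ) (hR : κ ∈ R) {β : ZFSet.{u}} (hβ : β ∈ κ) :
    ∃ κ' : ZFSet.{u}, κ' ∈ R ∧ κ' ∈ κ ∧ β ∈ κ' := by
  have hA : ({β} : ZFSet.{u}) ⊆ κ := by
    intro x hx
    rw [ZFSet.mem_singleton.1 hx]; exact hβ
  have h0 : ∅ ∈ HSet θ := by
    have := val2_HSet hθ h.1.1 h.2.1 hA 2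
    simpa [val2] using this
  obtain ⟨κ', F', h1, h2, h3⟩ := shrewd_reflect hθ h
    (φ := .and (.pred 1) (SF.bex 3 0 (.eq 3 3)))
    (.and (.pred 1) (dz_bex 3 0 (.eq 3 3))) (by
      intro i hi
      simp [SF.fv, SF.bex] at hi ⊢
      omega) hA h0 (by simp [sat_bex, Sat, Function.update, val2, hR, ZFSet.mem_singleton])
  simp [sat_bex, Sat, Function.update, val2, ZFSet.mem_inter, ZFSet.mem_singleton] at h3
  exact ⟨κ', h3.1, h2, h3.2⟩

theorem reflect_unbdd {R : Set ZFSet.{u}} {θ κ : ZFSet.{u}} (hθ : ZCard θ)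
    (h : WeaklyShrewdAt R 1 θ κ) (hR : κ ∈ R) {A : ZFSet.{u}} (hA : A ⊆ κ)
    (hu : ∀ x ∈ κ, ∃ y ∈ A, x ∈ y) :
    ∃ κ' : ZFSet.{u}, κ' ∈ R ∧ κ' ∈ κ ∧ ∀ x ∈ κ', ∃ y ∈ A, x ∈ y ∧ y ∈ κ' := by
  have h0 : ∅ ∈ HSet θ := by
    have := val2_HSet hθ h.1.1 h.2.1 hA 2
    simpa [val2] using this
  obtain ⟨κ', F', h1, h2, h3⟩ := shrewd_reflect hθ h
    (φ := .and (.pred 1) (SF.ball 3 1 (SF.bex 4 0 (.mem 3 4))))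
    (.and (.pred 1) (dz_ball 3 1 (dz_bex 4 0 (.mem 3 4)))) (by
      intro i hi
      simp [SF.fv, SF.bex, SF.ball] at hi ⊢
      omega) hA h0 (by
        simp [sat_bex, sat_ball, Sat, Function.update, val2, hR]
        exact hu)
  simp [sat_bex, sat_ball, Sat, Function.update, val2, ZFSet.mem_inter] at h3
  refine ⟨κ', h3.1, h2, fun x hx => ?_⟩
  obtain ⟨y, hy, hxy⟩ := h3.2 x hx
  exact ⟨y, hy.1, hxy, hy.2⟩

/-- Shrewdness implies regularity. -/
theorem regular_of_shrewd {R : Set ZFSet.{u}} {θ : ZFSet.{u}} {c : Cardinal.{u}}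
    (hθ : SuccCardOf θ c.ord.toZFSet) (h : WeaklyShrewdAt R 1 θ c.ord.toZFSet) :
    c.IsRegular := by
  classical
  have hc := infcard_ord.1 h.1
  refine ⟨hc, ?_⟩
  by_contra hlt
  push Not at hlt
  set l := c.ord.cof with hl
  have hlc : l.ord < c.ord := Cardinal.ord_lt_ord.2 hlt
  have hs0 : IsCofinal {a : Set.Iio c.ord | l.ord < a.1} := by
    rintro ⟨a, ha⟩
    refine ⟨⟨max a l.ord + 1, succ_lt_ord' hc (max_lt ha hlc)⟩, ?_, ?_⟩
    · exact lt_of_le_of_lt (le_max_right a l.ord) (Order.lt_add_one_iff.2 le_rfl)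
    · exact ((le_max_left a l.ord).trans (Order.lt_add_one_iff.2 le_rfl).le : a ≤ max a l.ord + 1)
  obtain ⟨t, ht1, ht2, ht3⟩ := Ordinal.exists_ord_cof_eq_of_isCofinal hs0
  rw [cof_Iio_ord] at ht3
  have htc : #t = Cardinal.lift.{u+1} l := by
    have := congrArg Ordinal.card ht3
    rwa [card_type, card_ord] at this
  have hIl : #(Set.Iio l.ord) = #t := by
    rw [Cardinal.mk_Iio_ordinal, card_ord, htc]
  obtain ⟨g⟩ := Cardinal.eq.1 hIl
  set κ := c.ord.toZFSet with hκdef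
  have hκord : κ.IsOrdinal := ZFSet.isOrdinal_toZFSet _
  have hκcard : κ.card = c := by rw [hκdef, card_toZFSet, card_ord]
  let A : ZFSet.{u} := ZFSet.sep (fun x => x = l.ord.toZFSet ∨ ∃ a : t, x = a.1.1.toZFSet) κ
  have hA : ∀ x, x ∈ A ↔ x = l.ord.toZFSet ∨ ∃ a : t, x = a.1.1.toZFSet := by
    intro x
    refine ZFSet.mem_sep.trans ⟨fun h => h.2, fun h => ⟨?_, h⟩⟩
    rcases h with rfl | ⟨a, rfl⟩
    · exact toZFSet_mem_toZFSet_iff.2 hlc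
    · exact toZFSet_mem_toZFSet_iff.2 a.1.2
  have hta : ∀ a : t, l.ord < a.1.1 := fun a => ht1 a.2
  let F : ZFSet.{u} := ZFSet.sep (fun p => ∃ x : Set.Iio l.ord,
    p = {x.1.toZFSet, (g x).1.1.toZFSet}) (ZFSet.powerset κ)
  have hF : ∀ p, p ∈ F ↔ ∃ x : Set.Iio l.ord, p = {x.1.toZFSet, (g x).1.1.toZFSet} := by
    intro x
    refine ZFSet.mem_sep.trans ⟨fun h => h.2, fun h => ⟨?_, h⟩⟩
    obtain ⟨y, rfl⟩ := h
    rw [ZFSet.mem_powerset]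
    intro z hz
    rcases ZFSet.mem_pair.1 hz with rfl | rfl
    · exact toZFSet_mem_toZFSet_iff.2 (lt_trans y.2 hlc)
    · exact toZFSet_mem_toZFSet_iff.2 (g y).1.2
  have hFκ : ∀ p ∈ F, p ⊆ κ := fun p hp => ZFSet.mem_powerset.1 (ZFSet.mem_sep.1 hp).1
  have hFcard : F.card ≤ l := by
    have h2 : #F.toSet ≤ #(Set.Iio l.ord) := by
      refine Cardinal.mk_le_of_surjective (f := fun x : Set.Iio l.ord =>
        ⟨{x.1.toZFSet, (g x).1.1.toZFSet}, (hF _).2 ⟨x, rfl⟩⟩) ?_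
      rintro ⟨y, hy⟩
      obtain ⟨x, rfl⟩ := (hF _).1 hy
      exact ⟨x, rfl⟩
    rw [hIl, htc, mk_toSet] at h2
    exact Cardinal.lift_le.1 h2
  have hFH : F ∈ HSet θ := by
    refine ⟨κ ∪ F, ?_, fun x hx => ZFSet.mem_union.2 (Or.inr hx), ?_⟩
    · intro x hx y hy
      rcases ZFSet.mem_union.1 hx with hx | hx
      · exact ZFSet.mem_union.2 (Or.inl (hκord.isTransitive x hx hy))
      · exact ZFSet.mem_union.2 (Or.inl (hFκ x hx hy))
    · rw [mk_lt_iff]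
      refine lt_of_le_of_lt ZFSet.card_union_le (lt_of_le_of_lt ?_ (succ_card_le hθ).1)
      rw [hκcard]
      exact (add_le_add le_rfl (hFcard.trans hlt.le)).trans (Cardinal.add_eq_self hc).le
  -- members of pairs
  have hpair1 : ∀ (x : Set.Iio l.ord) (z : ZFSet.{u}), z ∈ l.ord.toZFSet →
      z ∈ ({x.1.toZFSet, (g x).1.1.toZFSet} : ZFSet.{u}) → z = x.1.toZFSet := by
    intro x z hz h
    rcases ZFSet.mem_pair.1 h with h | rfl
    · exact h
    · exact absurd (toZFSet_mem_toZFSet_iff.1 hz) (hta _).le.not_gt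
  have hpair2 : ∀ (x : Set.Iio l.ord) (z : ZFSet.{u}), l.ord.toZFSet ∈ z →
      z ∈ ({x.1.toZFSet, (g x).1.1.toZFSet} : ZFSet.{u}) → z = (g x).1.1.toZFSet := by
    intro x z hz h
    rcases ZFSet.mem_pair.1 h with rfl | h
    · exact absurd (toZFSet_mem_toZFSet_iff.1 hz) (le_of_lt x.2).not_gt
    · exact h
  obtain ⟨κ', F', hκ', hκ'κ, hsat⟩ := shrewd_reflect hθ.1 h regF_dz regF_fv
    (A := A) ZFSet.sep_subset hFH (by
      rw [regF_sat]
      refine ⟨l.ord.toZFSet, (hA _).2 (Or.inl rfl), ?_, ?_, ?_⟩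
      · intro a ha h
        rcases (hA _).1 ha with rfl | ⟨a, rfl⟩
        · exact lt_irrefl _ (toZFSet_mem_toZFSet_iff.1 h)
        · exact absurd (toZFSet_mem_toZFSet_iff.1 h) (hta _).le.not_gt
      · intro x hx
        obtain ⟨y, hy, rfl⟩ := mem_toZFSet_iff.1 hx
        refine ⟨(g ⟨y, hy⟩).1.1.toZFSet, (hA _).2 (Or.inr ⟨_, rfl⟩),
          toZFSet_mem_toZFSet_iff.2 (hta _), _, (hF _).2 ⟨⟨y, hy⟩, rfl⟩, ?_, ?_⟩
        · exact ZFSet.mem_pair.2 (Or.inl rfl)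
        · exact ZFSet.mem_pair.2 (Or.inr rfl)
      · intro a ha p hp x hx q hq y hy hla hap hxp haq hyq
        obtain ⟨p, rfl⟩ := (hF _).1 hp
        obtain ⟨q, rfl⟩ := (hF _).1 hq
        rw [hpair1 p x hx hxp, hpair1 q y hy hyq]
        have h3 := (hpair2 p a hla hap).symm.trans (hpair2 q a hla haq)
        have h4 : p = q := g.injective (Subtype.ext (Subtype.ext (toZFSet_injective h3)))
        rw [h4])
  rw [regF_sat] at hsat
  obtain ⟨m, hm, hmin, hex, huniq⟩ := hsat
  obtain ⟨ρ, hρ, rfl⟩ := mem_toZFSet_iff.1 hκ'κ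
  have hA' : ∀ x, x ∈ A ∩ ρ.toZFSet ↔ x ∈ A ∧ x ∈ ρ.toZFSet := fun x => ZFSet.mem_inter
  have hml : m = l.ord.toZFSet := by
    obtain ⟨hmA, hmρ⟩ := (hA' m).1 hm
    rcases (hA m).1 hmA with h | ⟨a, rfl⟩
    · exact h
    · exact absurd (toZFSet_mem_toZFSet_iff.2 (hta a)) (hmin l.ord.toZFSet
        ((hA' _).2 ⟨(hA _).2 (Or.inl rfl),
          toZFSet_mem_toZFSet_iff.2 ((hta a).trans (toZFSet_mem_toZFSet_iff.1 hmρ))⟩))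
  subst hml
  obtain ⟨b, hb, hρb⟩ := ht2 ⟨ρ, hρ⟩
  have hcard : #{y : t // y < ⟨b, hb⟩} < Cardinal.lift.{u+1} l := by
    have := typein_lt_type (α := t) (· < ·) ⟨b, hb⟩
    rw [ht3] at this
    have := Cardinal.lt_ord.1 this
    rwa [card_typein] at this
  have hex' : ∀ x : Set.Iio l.ord, ∃ y : {y : t // y < ⟨b, hb⟩}, ∃ p ∈ F',
      x.1.toZFSet ∈ p ∧ y.1.1.1.toZFSet ∈ p ∧ y.1.1.1.toZFSet ∈ A ∩ ρ.toZFSet := by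
    intro x
    obtain ⟨a, ha, hla, p, hp, hxp, hap⟩ := hex x.1.toZFSet (toZFSet_mem_toZFSet_iff.2 x.2)
    obtain ⟨h1, h2⟩ := (hA' a).1 ha
    rcases (hA a).1 h1 with rfl | ⟨y, rfl⟩
    · exact absurd (toZFSet_mem_toZFSet_iff.1 hla) (lt_irrefl _)
    · refine ⟨⟨y, ?_⟩, p, hp, hxp, hap, ha⟩
      have h4 : y.1.1 < b.1 := lt_of_lt_of_le (toZFSet_mem_toZFSet_iff.1 h2) (show ρ ≤ b.1 from hρb)
      exact h4
  choose f p hp hxp hap haA using hex'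
  have hinj : Function.Injective f := by
    intro x y hxy
    have := huniq _ (haA x) _ (hp x) _ (toZFSet_mem_toZFSet_iff.2 x.2) _ (hp y) _
      (toZFSet_mem_toZFSet_iff.2 y.2) (toZFSet_mem_toZFSet_iff.2 (hta _)) (hap x) (hxp x)
      (by rw [hxy]; exact hap y) (hxp y)
    exact Subtype.ext (toZFSet_injective this)
  have := Cardinal.mk_le_of_injective hinj
  rw [hIl, htc] at this
  exact absurd hcard this.not_gt

theorem omega_lt_of_infcard {c : Cardinal.{u}} {x : ZFSet.{u}} (hx : InfCard x)
    (h : x ∈ c.ord.toZFSet) : ℵ₀ < c := by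
  obtain ⟨d, hd, rfl⟩ := infcard_iff.1 hx
  exact lt_of_le_of_lt hd (Cardinal.ord_lt_ord.1 (toZFSet_mem_toZFSet_iff.1 h))

theorem omega_mem {c : Cardinal.{u}} : ZFSet.omega ∈ c.ord.toZFSet ↔ ℵ₀ < c := by
  rw [omega_eq, toZFSet_mem_toZFSet_iff, ← Cardinal.ord_aleph0, Cardinal.ord_lt_ord]

theorem main_inacc {κ θ : ZFSet.{u}} (hθ : SuccCardOf θ κ) :
    WeaklyInacc κ ↔ WeaklyShrewdAt Cd 1 θ κ := by
  constructor
  · rintro ⟨hr, hω, hlim⟩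
    obtain ⟨c, hc, rfl⟩ := infcard_iff.1 hr.1
    have hreg := regular_of_zregular hr
    have hc' := omega_mem.1 hω
    refine shrewd_of_stationary (fun x hx => hx) hreg hc' hr.1 (cd_stationary hreg hc' ?_) hθ
    intro d hd
    obtain ⟨μ, h1, h2, h3⟩ := hlim d.ord.toZFSet
      (toZFSet_mem_toZFSet_iff.2 (Cardinal.ord_lt_ord.2 hd))
    obtain ⟨e, rfl⟩ := zcard_iff.1 h1
    rw [toZFSet_mem_toZFSet_iff, Cardinal.ord_lt_ord] at h2 h3
    exact lt_of_le_of_lt (Order.succ_le_of_lt h2) h3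
  · intro h
    obtain ⟨c, hc, rfl⟩ := infcard_iff.1 h.1
    have hreg := regular_of_shrewd hθ h
    refine ⟨zregular_of hreg, ?_, ?_⟩
    · obtain ⟨κ', h1, h2, _⟩ := reflect_pred hθ.1 h h.1
        (toZFSet_mem_toZFSet_iff.2 hreg.ord_pos)
      exact omega_mem.2 (omega_lt_of_infcard h1 h2)
    · intro β hβ
      obtain ⟨κ', h1, h2, h3⟩ := reflect_pred hθ.1 h h.1 hβ
      exact ⟨κ', h1.1, h3, h2⟩

theorem main_mahlo {κ θ : ZFSet.{u}} (hθ : SuccCardOf θ κ) :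
    WeaklyMahlo κ ↔ WeaklyShrewdAt Rg 1 θ κ := by
  constructor
  · rintro ⟨hr, hst⟩
    obtain ⟨c, hc, rfl⟩ := infcard_iff.1 hr.1
    have hreg := regular_of_zregular hr
    obtain ⟨γ, h1, h2⟩ := hst {x | x ∈ c.ord.toZFSet} ⟨fun _ h => h, by
      intro β hβ
      obtain ⟨b, hb, rfl⟩ := mem_toZFSet_iff.1 hβ
      exact ⟨(b + 1).toZFSet, toZFSet_mem_toZFSet_iff.2 (succ_lt_ord' hc hb),
        toZFSet_mem_toZFSet_iff.2 (Order.lt_add_one_iff.2 le_rfl)⟩, fun β hβ _ _ => hβ⟩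
    exact shrewd_of_stationary (fun x hx => hx.1) hreg (omega_lt_of_infcard h2.1 h1) hr hst hθ
  · intro h
    obtain ⟨c, hc, rfl⟩ := infcard_iff.1 h.1
    have hreg := zregular_of (regular_of_shrewd hθ h)
    refine ⟨hreg, ?_⟩
    rintro C ⟨hC1, hC2, hC3⟩
    obtain ⟨κ', h1, h2, h3⟩ := reflect_unbdd hθ.1 h hreg
      (A := ZFSet.sep (fun x => x ∈ C) c.ord.toZFSet) ZFSet.sep_subset (by
        intro x hx
        obtain ⟨y, hy, hxy⟩ := hC2 x hx
        exact ⟨y, ZFSet.mem_sep.2 ⟨hC1 y hy, hy⟩, hxy⟩)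
    refine ⟨κ', hC3 κ' h2 ⟨∅, h1.1.2 ZFSet.omega_zero⟩ ?_, h1⟩
    intro x hx
    obtain ⟨y, hy, hxy, hyκ⟩ := h3 x hx
    exact ⟨y, (ZFSet.mem_sep.1 hy).2, hxy, hyκ⟩

end Backward
/-- A cardinal `κ` is weakly inaccessible iff it is weakly `(Σ₁, Cd, κ⁺)`-shrewd,
and weakly Mahlo iff it is weakly `(Σ₁, Rg, κ⁺)`-shrewd. -/
theorem weaklyInacc_weaklyMahlo_iff (κ θ : ZFSet.{u}) (hθ : SuccCardOf θ κ) :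
    (WeaklyInacc κ ↔ WeaklyShrewdAt Cd 1 θ κ) ∧
      (WeaklyMahlo κ ↔ WeaklyShrewdAt Rg 1 θ κ) := by
  exact ⟨main_inacc hθ, main_mahlo hθ⟩
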